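/- Let T be a hypercyclic bounded linear operator on a separable Banach space X over 𝕜 (𝕜 = ℝ or ℂ). Then the following are equivalent: (i) T satisfies the Hypercyclicity Criterion; (ii) T ⊕ T is hypercyclic; (iii) T ⊕ T is cyclic; (iv) T satisfies the Cyclicity Criterion. -/

import Mathlib

open Filter Topology Polynomial

variable {𝕜 X : Type*} [RCLike 𝕜] [NormedAddCommGroup X] [NormedSpace 𝕜 X]

/-- `T` is hypercyclic: some vector has dense orbit. -/
def Hypercyclic (T : X →L[𝕜] X) : Prop :=
  ∃ x : X, Dense (Set.range fun n : ℕ => (T ^ n) x)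

/-- `T` is cyclic: the span of some orbit is dense. -/
def Cyclic (T : X →L[𝕜] X) : Prop :=
  ∃ x : X, Dense (Submodule.span 𝕜 (Set.range fun n : ℕ => (T ^ n) x) : Set X)

/-- The Hypercyclicity Criterion. -/
def HypercyclicityCriterion (T : X →L[𝕜] X) : Prop :=
  ∃ (X₀ Y₀ : Set X) (n : ℕ → ℕ) (S : ℕ → X → X),
    Dense X₀ ∧ Dense Y₀ ∧ StrictMono n ∧ (∀ k, 0 < n k) ∧
    (∀ x ∈ X₀, Tendsto (fun k => (T ^ n k) x) atTop (𝓝 0)) ∧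
    (∀ y ∈ Y₀, Tendsto (fun k => S k y) atTop (𝓝 0)) ∧
    (∀ y ∈ Y₀, Tendsto (fun k => (T ^ n k) (S k y)) atTop (𝓝 y))

/-- The Cyclicity Criterion. -/
def CyclicityCriterion (T : X →L[𝕜] X) : Prop :=
  ∃ (V W : Set X) (p : ℕ → Polynomial 𝕜) (S : ℕ → X → X),
    Dense V ∧ Dense W ∧
    (∀ x ∈ V, Tendsto (fun k => aeval T (p k) x) atTop (𝓝 0)) ∧
    (∀ x ∈ W, Tendsto (fun k => S k x) atTop (𝓝 0)) ∧
    (∀ x ∈ W, Tendsto (fun k => aeval T (p k) (S k x)) atTop (𝓝 x))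


lemma not_dense_orbit_finiteDimensional {E : Type*} [NormedAddCommGroup E] [NormedSpace 𝕜 E]
    [FiniteDimensional 𝕜 E] [Nontrivial E] (L : E →ₗ[𝕜] E) (v : E)
    (hv : Dense (Set.range fun n : ℕ => (L ^ n) v)) : False := by
  classical
  set n := Module.finrank 𝕜 E with hn
  have hn0 : 0 < n := Module.finrank_pos
  let w : Fin n → E := fun i => (L ^ (i : ℕ)) v
  have hmem : ∀ k : ℕ, (L ^ k) v ∈ Submodule.span 𝕜 (Set.range w) := by
    intro k
    have hdeg : ((X ^ k : 𝕜[X]) %ₘ L.charpoly).natDegree < n := by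
      have := Polynomial.natDegree_modByMonic_lt (X ^ k : 𝕜[X]) L.charpoly_monic (by
        intro h
        have h2 := L.charpoly_natDegree
        rw [h] at h2
        simp at h2
        omega)
      rwa [L.charpoly_natDegree] at this
    rw [LinearMap.pow_eq_aeval_mod_charpoly, aeval_eq_sum_range' hdeg, LinearMap.sum_apply]
    refine Submodule.sum_mem _ fun i hi => ?_
    rw [LinearMap.smul_apply]
    exact Submodule.smul_mem _ _ (Submodule.subset_span ⟨⟨i, Finset.mem_range.1 hi⟩, rfl⟩)
  have htop : ⊤ ≤ Submodule.span 𝕜 (Set.range w) := by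
    intro z _
    have hc : IsClosed (Submodule.span 𝕜 (Set.range w) : Set E) :=
      Submodule.closed_of_finiteDimensional _
    have := hv.mono (s₂ := (Submodule.span 𝕜 (Set.range w) : Set E))
      (by rintro _ ⟨k, rfl⟩; exact hmem k)
    have h2 := this z
    rwa [hc.closure_eq] at h2
  let b := basisOfTopLeSpanOfCardEqFinrank w htop (by simp [hn])
  have hb : ⇑b = w := coe_basisOfTopLeSpanOfCardEqFinrank _ _ _
  let f : E → 𝕜 := fun z => b.det fun i : Fin n => (L ^ (i : ℕ)) z
  have hfc : Continuous f := by
    have : f = fun z => (Matrix.of fun i j : Fin n => b.coord i ((L ^ (j : ℕ)) z)).det := by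
      funext z
      simp only [f, Module.Basis.det_apply]
      congr 1
    rw [this]
    refine Continuous.matrix_det ?_
    refine continuous_matrix fun i j => ?_
    exact (LinearMap.continuous_of_finiteDimensional ((b.coord i) ∘ₗ (L ^ (j : ℕ))))
  have hfv : f v = 1 := by
    have : f v = b.det w := rfl
    rw [this, ← hb, b.det_self]
  have hfL : ∀ z, f (L z) = LinearMap.det L * f z := by
    intro z
    simp only [f]
    rw [← b.det_comp]
    congr 1
    funext i
    simp only [Function.comp]
    rw [← Module.End.mul_apply, ← pow_succ, pow_succ', Module.End.mul_apply]
  have hfk : ∀ k : ℕ, f ((L ^ k) v) = LinearMap.det L ^ k := by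
    intro k
    induction k with
    | zero => simpa using hfv
    | succ k ih => rw [pow_succ', Module.End.mul_apply, hfL, ih, pow_succ']
  have hf0 : f 0 = 0 := by
    simp only [f, map_zero]
    exact b.det.map_coord_zero (⟨0, hn0⟩ : Fin n) rfl
  have hf2 : f ((2 : 𝕜) • v) = 2 ^ n := by
    have : f ((2 : 𝕜) • v) = b.det fun i : Fin n => (2 : 𝕜) • (L ^ (i : ℕ)) v := by
      simp only [f, map_smul]
    rw [this]
    have h := b.det.toMultilinearMap.map_smul_univ (fun _ : Fin n => (2 : 𝕜)) w
    simp only [Finset.prod_const, Finset.card_univ, Fintype.card_fin] at h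
    refine h.trans ?_
    have : b.det.toMultilinearMap w = f v := rfl
    rw [this, hfv]
    simp
  rcases le_total ‖LinearMap.det L‖ 1 with h | h
  · have hcl : IsClosed {z | ‖f z‖ ≤ 1} := isClosed_le hfc.norm continuous_const
    have hall : (2 : 𝕜) • v ∈ {z | ‖f z‖ ≤ 1} := by
      refine hcl.closure_subset_iff.2 ?_ (hv _)
      rintro _ ⟨k, rfl⟩
      simp only [Set.mem_ofPred_eq, hfk, norm_pow]
      exact pow_le_one₀ (norm_nonneg _) h
    simp only [Set.mem_ofPred_eq, hf2, norm_pow, RCLike.norm_ofNat] at hall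
    have := one_lt_pow₀ (one_lt_two : (1 : ℝ) < 2) hn0.ne'
    linarith
  · have hcl : IsClosed {z | 1 ≤ ‖f z‖} := isClosed_le continuous_const hfc.norm
    have hall : (0 : E) ∈ {z | 1 ≤ ‖f z‖} := by
      refine hcl.closure_subset_iff.2 ?_ (hv _)
      rintro _ ⟨k, rfl⟩
      simp only [Set.mem_ofPred_eq, hfk, norm_pow]
      exact one_le_pow₀ h
    simp only [Set.mem_ofPred_eq, hf0, norm_zero] at hall
    linarith

lemma denseRange_aeval (T : X →L[𝕜] X) (hT : Hypercyclic T) (p : 𝕜[X]) (hp : p ≠ 0) :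
    DenseRange (aeval T p) := by
  obtain ⟨x, hx⟩ := hT
  set R : Submodule 𝕜 X := LinearMap.range (aeval T p : X →L[𝕜] X).toLinearMap with hR
  set Y : Submodule 𝕜 X := R.topologicalClosure with hY
  have hYc : IsClosed (Y : Set X) := R.isClosed_topologicalClosure
  have hcomm : ∀ z, aeval T p (T z) = T (aeval T p z) := by
    intro z
    have h : aeval T (p * Polynomial.X) = aeval T (Polynomial.X * p) := by rw [mul_comm]
    rw [map_mul, map_mul, aeval_X] at h
    exact DFunLike.congr_fun h z
  have hinv : Y ≤ Y.comap T.toLinearMap := by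
    intro z hz
    have hz' : z ∈ closure (R : Set X) := hz
    have : T z ∈ closure (R : Set X) := by
      refine map_mem_closure T.continuous hz' ?_
      rintro _ ⟨y, rfl⟩
      exact ⟨T y, hcomm y⟩
    exact this
  by_cases htop : Y = ⊤
  · intro z
    have : z ∈ Y := by rw [htop]; trivial
    have h2 : z ∈ closure (R : Set X) := this
    have h3 : (R : Set X) = Set.range (aeval T p) := by
      rw [hR]; rfl
    rwa [h3] at h2
  exfalso
  haveI : IsClosed (Y : Set X) := hYc
  haveI : Nontrivial (X ⧸ Y) := Submodule.Quotient.nontrivial_iff.2 htop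
  let L : (X ⧸ Y) →ₗ[𝕜] (X ⧸ Y) := Y.mapQ Y T.toLinearMap hinv
  have hL : ∀ z, L (Y.mkQ z) = Y.mkQ (T z) := fun z => rfl
  have hLk : ∀ (k : ℕ) z, (L ^ k) (Y.mkQ z) = Y.mkQ ((T ^ k) z) := by
    intro k
    induction k with
    | zero => intro z; rfl
    | succ k ih =>
      intro z
      rw [pow_succ, pow_succ, Module.End.mul_apply, hL, ih]; rfl
  have hLp : ∀ (q : 𝕜[X]) z, aeval L q (Y.mkQ z) = Y.mkQ (aeval T q z) := by
    intro q z
    induction q using Polynomial.induction_on' with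
    | add a b ha hb => simp only [map_add, LinearMap.add_apply, ContinuousLinearMap.add_apply, ha, hb]
    | monomial k a =>
      simp only [aeval_monomial, Algebra.algebraMap_eq_smul_one, smul_mul_assoc, one_mul,
        LinearMap.smul_apply, ContinuousLinearMap.smul_apply, hLk, map_smul]
  have hzero : aeval L p = 0 := by
    ext z
    change aeval L p (Y.mkQ z) = 0
    rw [hLp, Submodule.mkQ_apply, Submodule.Quotient.mk_eq_zero]
    exact R.le_topologicalClosure ⟨z, rfl⟩
  have hint : IsIntegral 𝕜 L := by
    have : IsAlgebraic 𝕜 L := ⟨p, hp, hzero⟩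
    exact this.isIntegral
  have hd : Dense (Set.range fun k : ℕ => (L ^ k) (Y.mkQ x)) := by
    have hq : DenseRange (Y.mkQ) := (Submodule.mkQ_surjective Y).denseRange
    have hqc : Continuous (Y.mkQ) := Y.mkQL.continuous
    have := hq.dense_image hqc hx
    refine this.mono ?_
    rintro _ ⟨_, ⟨k, rfl⟩, rfl⟩
    exact ⟨k, hLk k x⟩
  let F : Submodule 𝕜 (X ⧸ Y) :=
    (Subalgebra.toSubmodule (Algebra.adjoin 𝕜 {L})).map (LinearMap.applyₗ (Y.mkQ x))
  have hF : F.FG := Submodule.FG.map _ hint.fg_adjoin_singleton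
  haveI : FiniteDimensional 𝕜 F := Module.Finite.iff_fg.2 hF
  have hFc : IsClosed (F : Set (X ⧸ Y)) := Submodule.closed_of_finiteDimensional _
  have hFtop : F = ⊤ := by
    rw [eq_top_iff]
    intro z _
    have hm : (Set.range fun k : ℕ => (L ^ k) (Y.mkQ x)) ⊆ (F : Set (X ⧸ Y)) := by
      rintro _ ⟨k, rfl⟩
      exact ⟨L ^ k, Subalgebra.pow_mem _ (Algebra.self_mem_adjoin_singleton 𝕜 L) k, rfl⟩
    exact hFc.closure_subset_iff.2 hm (hd z)
  haveI : FiniteDimensional 𝕜 (X ⧸ Y) := by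
    rw [hFtop] at hF
    exact ⟨hF⟩
  exact not_dense_orbit_finiteDimensional L _ hd

lemma denseRange_pow (T : X →L[𝕜] X) (hT : Hypercyclic T) (k : ℕ) : DenseRange (T ^ k) := by
  have := denseRange_aeval T hT (Polynomial.X ^ k) (pow_ne_zero _ X_ne_zero)
  simpa using this

lemma dense_tail (T : X →L[𝕜] X) (x : X) (hx : Dense (Set.range fun n : ℕ => (T ^ n) x)) (N : ℕ) :
    Dense (Set.range fun n : ℕ => (T ^ (N + n)) x) := by
  have := (denseRange_pow T ⟨x, hx⟩ N).dense_image (T ^ N).continuous hx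
  refine this.mono ?_
  rintro _ ⟨_, ⟨k, rfl⟩, rfl⟩
  exact ⟨k, by simp only [pow_add]; rfl⟩

lemma Hypercyclic.transitive {T : X →L[𝕜] X} (hT : Hypercyclic T) {U V : Set X}
    (hU : IsOpen U) (hV : IsOpen V) (hU' : U.Nonempty) (hV' : V.Nonempty) :
    ∃ n : ℕ, ∃ z ∈ U, (T ^ n) z ∈ V := by
  obtain ⟨x, hx⟩ := hT
  obtain ⟨_, hn, n, rfl⟩ := hx.inter_open_nonempty U hU hU'
  obtain ⟨_, hm, m, rfl⟩ := (dense_tail T x hx n).inter_open_nonempty V hV hV'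
  refine ⟨m, (T ^ n) x, hn, ?_⟩
  have : (T ^ (n + m)) x = (T ^ m) ((T ^ n) x) := by rw [add_comm, pow_add]; rfl
  rwa [← this]

lemma prodMap_pow_apply (T : X →L[𝕜] X) (n : ℕ) (z : X × X) :
    ((T.prodMap T) ^ n) z = ((T ^ n) z.1, (T ^ n) z.2) := by
  induction n generalizing z with
  | zero => rfl
  | succ n ih =>
    rw [pow_succ, pow_succ]
    exact ih _

/-- Birkhoff transitivity theorem. -/
lemma hypercyclic_of_transitive {E : Type*} [NormedAddCommGroup E] [NormedSpace 𝕜 E]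
    [CompleteSpace E] [TopologicalSpace.SeparableSpace E] (A : E →L[𝕜] E)
    (h : ∀ U V : Set E, IsOpen U → IsOpen V → U.Nonempty → V.Nonempty →
      ∃ n : ℕ, ∃ z ∈ U, (A ^ n) z ∈ V) : Hypercyclic A := by
  haveI : SecondCountableTopology E := UniformSpace.secondCountable_of_separable E
  obtain ⟨B, hBc, hBe, hB⟩ := TopologicalSpace.exists_countable_basis E
  have hd : Dense (⋂ s ∈ B, ⋃ n : ℕ, (A ^ n) ⁻¹' s) := by
    refine dense_biInter_of_isOpen ?_ hBc ?_
    · intro s hs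
      exact isOpen_iUnion fun n => (hB.isOpen hs).preimage (A ^ n).continuous
    · intro s hs
      refine dense_iff_inter_open.2 fun U hU hU' => ?_
      have hne : s.Nonempty := Set.nonempty_iff_ne_empty.2 fun h0 => hBe (h0 ▸ hs)
      obtain ⟨n, z, hz, hz'⟩ := h U s hU (hB.isOpen hs) hU' hne
      exact ⟨z, hz, Set.mem_iUnion.2 ⟨n, hz'⟩⟩
  obtain ⟨x, hx⟩ := hd.nonempty
  refine ⟨x, hB.dense_iff.2 fun s hs _ => ?_⟩
  obtain ⟨n, hn⟩ := Set.mem_iUnion.1 (Set.mem_iInter₂.1 hx s hs)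
  exact ⟨_, hn, n, rfl⟩

lemma exists_box {U : Set (X × X)} (hU : IsOpen U) (hU' : U.Nonempty) :
    ∃ A B : Set X, IsOpen A ∧ IsOpen B ∧ A.Nonempty ∧ B.Nonempty ∧ A ×ˢ B ⊆ U := by
  obtain ⟨⟨a, b⟩, hab⟩ := hU'
  obtain ⟨A, B, hA, hB, ha, hb, h⟩ := isOpen_prod_iff.1 hU a b hab
  exact ⟨A, B, hA, hB, ⟨a, ha⟩, ⟨b, hb⟩, h⟩

/-- The four set trick. -/
lemma hypercyclic_prod_of_poly [CompleteSpace X] [TopologicalSpace.SeparableSpace X]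
    (T : X →L[𝕜] X) (hT : Hypercyclic T)
    (h : ∀ U₁ V₁ U₂ V₂ : Set X, IsOpen U₁ → IsOpen V₁ → IsOpen U₂ → IsOpen V₂ →
      U₁.Nonempty → V₁.Nonempty → U₂.Nonempty → V₂.Nonempty →
      ∃ p : 𝕜[X], (∃ u ∈ U₁, aeval T p u ∈ U₂) ∧ (∃ v ∈ V₁, aeval T p v ∈ V₂)) :
    Hypercyclic (T.prodMap T) := by
  refine hypercyclic_of_transitive _ fun U V hU hV hU' hV' => ?_
  obtain ⟨U₁, U₂, hU₁, hU₂, hU₁', hU₂', hUs⟩ := exists_box hU hU'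
  obtain ⟨V₁, V₂, hV₁, hV₂, hV₁', hV₂', hVs⟩ := exists_box hV hV'
  obtain ⟨p, ⟨u, hu, hu'⟩, ⟨v, hv, hv'⟩⟩ :=
    h U₁ V₁ U₂ V₂ hU₁ hV₁ hU₂ hV₂ hU₁' hV₁' hU₂' hV₂'
  obtain ⟨n, z, hz, hz'⟩ := hT.transitive
    (hU₁.inter (hU₂.preimage (aeval T p).continuous))
    (hV₁.inter (hV₂.preimage (aeval T p).continuous)) ⟨u, hu, hu'⟩ ⟨v, hv, hv'⟩
  refine ⟨n, (z, aeval T p z), hUs ⟨hz.1, hz.2⟩, hVs ?_⟩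
  rw [prodMap_pow_apply]
  refine ⟨hz'.1, ?_⟩
  have hc : aeval T (p * Polynomial.X ^ n) = aeval T (Polynomial.X ^ n * p) := by rw [mul_comm]
  rw [map_mul, map_mul, map_pow, aeval_X] at hc
  have := DFunLike.congr_fun hc z
  have h2 : (T ^ n) (aeval T p z) = aeval T p ((T ^ n) z) := this.symm
  change (T ^ n) (aeval T p z) ∈ V₂
  rw [h2]
  exact hz'.2

lemma hypercyclic_prod_of_cyclicityCriterion
    [CompleteSpace X] [TopologicalSpace.SeparableSpace X]
    (T : X →L[𝕜] X) (hT : Hypercyclic T) (hC : CyclicityCriterion T) :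
    Hypercyclic (T.prodMap T) := by
  obtain ⟨V, W, p, S, hV, hW, h1, h2, h3⟩ := hC
  have key : ∀ A B : Set X, IsOpen A → IsOpen B → A.Nonempty → B.Nonempty →
      ∀ᶠ k in atTop, ∃ u ∈ A, aeval T (p k) u ∈ B := by
    intro A B hA hB hA' hB'
    obtain ⟨a, haA, haV⟩ := hV.inter_open_nonempty A hA hA'
    obtain ⟨b, hbB, hbW⟩ := hW.inter_open_nonempty B hB hB'
    have t1 : Tendsto (fun k => a + S k b) atTop (𝓝 a) := by
      simpa using tendsto_const_nhds.add (h2 b hbW)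
    have t2 : Tendsto (fun k => aeval T (p k) (a + S k b)) atTop (𝓝 b) := by
      simpa using (h1 a haV).add (h3 b hbW)
    filter_upwards [t1.eventually (hA.mem_nhds haA), t2.eventually (hB.mem_nhds hbB)] with k e1 e2
    exact ⟨_, e1, e2⟩
  refine hypercyclic_prod_of_poly T hT ?_
  intro U₁ V₁ U₂ V₂ hU₁ hV₁ hU₂ hV₂ hU₁' hV₁' hU₂' hV₂'
  obtain ⟨k, hk⟩ := ((key U₁ U₂ hU₁ hU₂ hU₁' hU₂').and (key V₁ V₂ hV₁ hV₂ hV₁' hV₂')).exists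
  exact ⟨p k, hk⟩

lemma hypercyclic_prod_of_cyclic
    [CompleteSpace X] [TopologicalSpace.SeparableSpace X]
    (T : X →L[𝕜] X) (hT : Hypercyclic T) (hC : Cyclic (T.prodMap T)) :
    Hypercyclic (T.prodMap T) := by
  obtain ⟨⟨x, y⟩, hxy⟩ := hC
  have hd : DenseRange (fun q : 𝕜[X] => ((aeval T q x, aeval T q y) : X × X)) := by
    let φ : 𝕜[X] →ₗ[𝕜] X × X :=
      { toFun := fun q => (aeval T q x, aeval T q y)
        map_add' := fun a b => by simp
        map_smul' := fun c a => by simp }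
    refine hxy.mono ?_
    have : Submodule.span 𝕜 (Set.range fun n : ℕ => ((T.prodMap T) ^ n) (x, y))
        ≤ LinearMap.range φ := by
      rw [Submodule.span_le]
      rintro _ ⟨n, rfl⟩
      refine ⟨Polynomial.X ^ n, ?_⟩
      simp only [prodMap_pow_apply]
      change (aeval T (Polynomial.X ^ n) x, aeval T (Polynomial.X ^ n) y) = _
      simp
    intro z hz
    exact this hz
  refine hypercyclic_prod_of_poly T hT ?_
  intro U₁ V₁ U₂ V₂ hU₁ hV₁ hU₂ hV₂ hU₁' hV₁' hU₂' hV₂'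
  rcases subsingleton_or_nontrivial X with hs | hs
  · obtain ⟨u, hu⟩ := hU₁'
    obtain ⟨v, hv⟩ := hV₁'
    obtain ⟨u', hu'⟩ := hU₂'
    obtain ⟨v', hv'⟩ := hV₂'
    exact ⟨1, ⟨u, hu, by rwa [Subsingleton.elim (aeval T (1 : 𝕜[X]) u) u']⟩,
      ⟨v, hv, by rwa [Subsingleton.elim (aeval T (1 : 𝕜[X]) v) v']⟩⟩
  · have hne : (U₁ ∩ {0}ᶜ).Nonempty := by
      haveI : (𝓝[≠] (0 : X)).NeBot := Module.punctured_nhds_neBot 𝕜 X 0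
      exact (dense_compl_singleton (0 : X)).inter_open_nonempty U₁ hU₁ hU₁'
    obtain ⟨p, hp⟩ := hd.exists_mem_open
      ((hU₁.inter isOpen_compl_singleton).prod hV₁) (hne.prod hV₁')
    have hp0 : p ≠ 0 := by
      rintro rfl
      exact hp.1.2 (by simp)
    have hr := denseRange_aeval T hT p hp0
    have hd2 := (hr.prodMap hr).comp hd
      ((aeval T p).continuous.prodMap (aeval T p).continuous)
    obtain ⟨q, hq⟩ := hd2.exists_mem_open (hU₂.prod hV₂) (hU₂'.prod hV₂')
    have hc : ∀ z, aeval T q (aeval T p z) = aeval T p (aeval T q z) := by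
      intro z
      have h : aeval T (q * p) = aeval T (p * q) := by rw [mul_comm]
      rw [map_mul, map_mul] at h
      exact DFunLike.congr_fun h z
    refine ⟨q, ⟨_, hp.1.1, ?_⟩, ⟨_, hp.2, ?_⟩⟩
    · rw [hc]; exact hq.1
    · rw [hc]; exact hq.2

lemma hypercyclicityCriterion_of_prod (T : X →L[𝕜] X) (hT : Hypercyclic T)
    (hP : Hypercyclic (T.prodMap T)) : HypercyclicityCriterion T := by
  obtain ⟨⟨x, y⟩, hxy⟩ := hP
  have hx : Dense (Set.range fun n : ℕ => (T ^ n) x) := by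
    have := Prod.fst_surjective.denseRange.dense_image (continuous_fst (X := X) (Y := X)) hxy
    refine this.mono ?_
    rintro _ ⟨_, ⟨k, rfl⟩, rfl⟩
    exact ⟨k, by simp [prodMap_pow_apply]⟩
  have hy : Dense (Set.range fun n : ℕ => (T ^ n) y) := by
    have := Prod.snd_surjective.denseRange.dense_image (continuous_snd (X := X) (Y := X)) hxy
    refine this.mono ?_
    rintro _ ⟨_, ⟨k, rfl⟩, rfl⟩
    exact ⟨k, by simp [prodMap_pow_apply]⟩
  have step : ∀ (ε : ℝ), 0 < ε → ∀ N : ℕ, ∃ n : ℕ, N < n ∧ ∃ u : X,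
      ‖u‖ < ε ∧ ‖(T ^ n) x‖ < ε ∧ ‖(T ^ n) u - x‖ < ε := by
    intro ε hε N
    obtain ⟨_, hm, m, rfl⟩ := hy.inter_open_nonempty (Metric.ball 0 ε) Metric.isOpen_ball
      ⟨0, Metric.mem_ball_self hε⟩
    have hd0 := dense_tail (T.prodMap T) (x, y) hxy (N + 1)
    have hr : DenseRange (Prod.map (id : X → X) (T ^ m)) :=
      Function.surjective_id.denseRange.prodMap (denseRange_pow T hT m)
    have hd := hr.dense_image (continuous_id.prodMap (T ^ m).continuous) hd0
    obtain ⟨_, ⟨h1, h2⟩, _, ⟨k, rfl⟩, rfl⟩ := hd.inter_open_nonempty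
      (Metric.ball 0 ε ×ˢ Metric.ball x ε) (Metric.isOpen_ball.prod Metric.isOpen_ball)
      ⟨(0, x), Metric.mem_ball_self hε, Metric.mem_ball_self hε⟩
    simp only [prodMap_pow_apply, Prod.map, id] at h1 h2
    refine ⟨N + 1 + k, by omega, (T ^ m) y, by simpa using hm, by simpa using h1, ?_⟩
    have : (T ^ (N + 1 + k)) ((T ^ m) y) = (T ^ m) ((T ^ (N + 1 + k)) y) := by
      rw [← ContinuousLinearMap.mul_apply, ← ContinuousLinearMap.mul_apply, ← pow_add,
        ← pow_add, add_comm]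
    rw [this]
    simpa [dist_eq_norm] using h2
  choose! g hg u hu1 hu2 hu3 using step
  let e : ℕ → ℝ := fun k => 1 / ((k : ℝ) + 1)
  have he : ∀ k, 0 < e k := fun k => Nat.one_div_pos_of_nat
  have het : Tendsto e atTop (𝓝 0) := tendsto_one_div_add_atTop_nhds_zero_nat
  -- previous value: n' 0 = 0, n' (k+1) = g (e k) (n' k)
  let n' : ℕ → ℕ := fun k => Nat.rec 0 (fun k r => g (e k) r) k
  have hn' : ∀ k, n' (k + 1) = g (e k) (n' k) := fun k => rfl
  have hmono : StrictMono n' := strictMono_nat_of_lt_succ fun k => by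
    rw [hn']; exact hg _ (he k) _
  let w : ℕ → X := fun k => u (e k) (n' k)
  have w1 : Tendsto w atTop (𝓝 0) :=
    squeeze_zero_norm (fun k => (hu1 _ (he k) (n' k)).le) het
  have w2 : Tendsto (fun k => (T ^ n' (k + 1)) x) atTop (𝓝 0) :=
    squeeze_zero_norm (fun k => (hu2 _ (he k) (n' k)).le) het
  have w3 : Tendsto (fun k => (T ^ n' (k + 1)) (w k)) atTop (𝓝 x) := by
    rw [tendsto_iff_norm_sub_tendsto_zero]
    exact squeeze_zero (fun _ => norm_nonneg _) (fun k => (hu3 _ (he k) (n' k)).le) het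
  have hcomm : ∀ (a b : ℕ) z, (T ^ a) ((T ^ b) z) = (T ^ b) ((T ^ a) z) := by
    intro a b z
    rw [← ContinuousLinearMap.mul_apply, ← ContinuousLinearMap.mul_apply, ← pow_add,
      ← pow_add, add_comm]
  have hsel : ∀ z : X, ∃ m : ℕ, z ∈ (Set.range fun n : ℕ => (T ^ n) x) → (T ^ m) x = z := by
    intro z
    by_cases hz : z ∈ (Set.range fun n : ℕ => (T ^ n) x)
    · obtain ⟨m, hm⟩ := hz
      exact ⟨m, fun _ => hm⟩
    · exact ⟨0, fun h => absurd h hz⟩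
  choose μ hμ using hsel
  refine ⟨Set.range fun n : ℕ => (T ^ n) x, Set.range fun n : ℕ => (T ^ n) x,
    fun k => n' (k + 1), fun k z => (T ^ μ z) (w k), hx, hx, ?_, ?_, ?_, ?_, ?_⟩
  · exact fun a b hab => hmono (Nat.succ_lt_succ hab)
  · exact fun k => lt_of_le_of_lt (Nat.zero_le _) (hmono (Nat.lt_succ_self k))
  · rintro _ ⟨m, rfl⟩
    have := ((T ^ m).continuous.tendsto 0).comp w2
    rw [map_zero] at this
    refine this.congr fun k => ?_
    exact hcomm _ _ _
  · intro z _
    have := ((T ^ μ z).continuous.tendsto 0).comp w1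
    rw [map_zero] at this
    exact this
  · intro z hz
    have := ((T ^ μ z).continuous.tendsto x).comp w3
    rw [hμ z hz] at this
    refine this.congr fun k => ?_
    exact hcomm _ _ _

theorem hypercyclic_tfae [CompleteSpace X] [TopologicalSpace.SeparableSpace X]
    (T : X →L[𝕜] X) (hT : Hypercyclic T) :
    List.TFAE [HypercyclicityCriterion T,
               Hypercyclic (T.prodMap T),
               Cyclic (T.prodMap T),
               CyclicityCriterion T] := by
  tfae_have 1 → 4 := by
    rintro ⟨X₀, Y₀, n, S, h1, h2, _, _, h3, h4, h5⟩
    exact ⟨X₀, Y₀, fun k => Polynomial.X ^ n k, S, h1, h2, fun x hx => by simpa using h3 x hx, h4,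
      fun x hx => by simpa using h5 x hx⟩
  tfae_have 4 → 2 := hypercyclic_prod_of_cyclicityCriterion T hT
  tfae_have 2 → 3 := fun ⟨x, hx⟩ => ⟨x, hx.mono Submodule.subset_span⟩
  tfae_have 3 → 2 := hypercyclic_prod_of_cyclic T hT
  tfae_have 2 → 1 := hypercyclicityCriterion_of_prod T hT
  tfae_finish
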